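/- For all real numbers 0 < δ < b and every κ > 0 there exist ρ > 0 and a C^∞ function χ : ℝ → ℝ such that χ(s) = κ(s − δ) for all s ≤ δ, χ(s) = ρ for all s ≥ b, χ is concave, and χ is nondecreasing. -/

import Mathlib

/-- Construction of the auxiliary concave function `χ^κ_{δ,ρ}`: a `C^∞` concave
nondecreasing function equal to `κ(s − δ)` on `(-∞,δ]` and constant equal to some
`ρ > 0` on `[b,∞)`. -/
theorem exists_concave_smoothing_function (δ b κ : ℝ) (hδ : 0 < δ) (hδb : δ < b)
    (hκ : 0 < κ) :
    ∃ ρ : ℝ, 0 < ρ ∧ ∃ χ : ℝ → ℝ, ContDiff ℝ (⊤ : ℕ∞) χ ∧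
      (∀ s ≤ δ, χ s = κ * (s - δ)) ∧
      (∀ s ≥ b, χ s = ρ) ∧
      ConcaveOn ℝ Set.univ χ ∧
      Monotone χ := by
  have hd : 0 < b - δ := sub_pos.2 hδb
  obtain ⟨g, hg⟩ : ∃ g : ℝ → ℝ, g = fun t => κ * Real.smoothTransition ((b - t) / (b - δ)) :=
    ⟨_, rfl⟩
  have hgs : ContDiff ℝ (⊤ : ℕ∞) g := by
    rw [hg]
    exact contDiff_const.mul (Real.smoothTransition.contDiff.comp
      ((contDiff_const.sub contDiff_id).div_const _))
  have hgc : Continuous g := hgs.continuous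
  have hg0 : ∀ t, 0 ≤ g t := fun t => by
    rw [hg]; exact mul_nonneg hκ.le (Real.smoothTransition.nonneg _)
  have hanti : Antitone g := by
    intro x y hxy
    rw [hg]
    refine mul_le_mul_of_nonneg_left (Real.smoothTransition.monotone ?_) hκ.le
    gcongr
  have hder : ∀ s, HasDerivAt (fun s => ∫ t in δ..s, g t) (g s) s := fun s =>
    intervalIntegral.integral_hasDerivAt_right (hgc.intervalIntegrable _ _)
      (hgc.stronglyMeasurableAtFilter _ _) hgc.continuousAt
  have hdiff : Differentiable ℝ (fun s => ∫ t in δ..s, g t) :=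
    fun s => (hder s).differentiableAt
  have hderiv : deriv (fun s => ∫ t in δ..s, g t) = g := funext fun s => (hder s).deriv
  refine ⟨∫ t in δ..b, g t, ?_, fun s => ∫ t in δ..s, g t, ?_, ?_, ?_, ?_, ?_⟩
  · refine intervalIntegral.intervalIntegral_pos_of_pos_on (hgc.intervalIntegrable _ _) ?_ hδb
    intro x hx
    rw [hg]
    exact mul_pos hκ (Real.smoothTransition.pos_of_pos (div_pos (sub_pos.2 hx.2) hd))
  · refine contDiff_infty_iff_deriv.2 ⟨hdiff, ?_⟩
    rw [hderiv]; exact hgs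
  · intro s hs
    have h : ∫ t in δ..s, g t = ∫ t in δ..s, κ := by
      refine intervalIntegral.integral_congr ?_
      intro t ht
      rw [Set.uIcc_of_ge hs] at ht
      have h1 : Real.smoothTransition ((b - t) / (b - δ)) = 1 :=
        Real.smoothTransition.one_of_one_le ((one_le_div hd).2 (by linarith [ht.2]))
      simp [hg, h1]
    simp only [h, intervalIntegral.integral_const, smul_eq_mul]
    ring
  · intro s hs
    have h : ∫ t in b..s, g t = ∫ t in b..s, (0 : ℝ) := by
      refine intervalIntegral.integral_congr ?_
      intro t ht
      rw [Set.uIcc_of_le hs] at ht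
      have h1 : Real.smoothTransition ((b - t) / (b - δ)) = 0 :=
        Real.smoothTransition.zero_of_nonpos
          (div_nonpos_of_nonpos_of_nonneg (by linarith [ht.1]) hd.le)
      simp [hg, h1]
    have h2 := intervalIntegral.integral_add_adjacent_intervals
      (hgc.intervalIntegrable (μ := MeasureTheory.volume) δ b) (hgc.intervalIntegrable b s)
    rw [h] at h2
    simp only [intervalIntegral.integral_zero, add_zero] at h2
    exact h2.symm
  · refine Antitone.concaveOn_univ_of_deriv hdiff ?_
    rw [hderiv]; exact hanti
  · refine monotone_of_deriv_nonneg hdiff ?_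
    intro x
    rw [hderiv]; exact hg0 x
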